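/- arXiv:1808.10386 — 2 statements merged into one kernel-verified Lean document; each statement's English description precedes it below -/
import Mathlib

section
/- Let u be a smooth axially symmetric solution of the stationary Navier–Stokes system (ASNS) with smooth axially symmetric pressure p on the slab ℝ²×[0,1], satisfying the Dirichlet boundary condition u = 0 at z = 0 and z = 1, u(x) → 0 uniformly as r = |x'| → ∞, and the dyadic Dirichlet bound ∫₀¹∫_{R≤r≤2R} |∇u|² r dr dz ≤ C_D for all R ≥ 1. Let w^r = −∂_z u^θ and w^z = ∂_r u^θ + u^θ/r be the radial and vertical vorticity components. Then there exist a constant C > 0, depending only on C_D and on the supremum norms of u and its derivatives up to order two, and r₀ ≥ 2 such that |w^r(r,z)| + |w^z(r,z)| ≤ C r^{−1} ln r for all r ≥ r₀ and z ∈ [0,1]. -/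
open MeasureTheory Real

/-- `∂_r f` for a function `f = f(r,z)`. -/
noncomputable def pdr (f : ℝ → ℝ → ℝ) (r z : ℝ) : ℝ := deriv (fun s => f s z) r

/-- `∂_z f` for a function `f = f(r,z)`. -/
noncomputable def pdz (f : ℝ → ℝ → ℝ) (r z : ℝ) : ℝ := deriv (fun t => f r t) z

/-- The axially symmetric stationary Navier–Stokes system (ASNS), imposed for all
`r > 0` and all `z ∈ S`. -/
def ASNS (ur uθ uz p : ℝ → ℝ → ℝ) (S : Set ℝ) : Prop :=
  ∀ r : ℝ, 0 < r → ∀ z ∈ S,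
    ((ur r z * pdr ur r z + uz r z * pdz ur r z) - (uθ r z) ^ 2 / r + pdr p r z
        = pdr (pdr ur) r z + (1 / r) * pdr ur r z + pdz (pdz ur) r z - ur r z / r ^ 2)
    ∧ ((ur r z * pdr uθ r z + uz r z * pdz uθ r z) + ur r z * uθ r z / r
        = pdr (pdr uθ) r z + (1 / r) * pdr uθ r z + pdz (pdz uθ) r z - uθ r z / r ^ 2)
    ∧ ((ur r z * pdr uz r z + uz r z * pdz uz r z) + pdz p r z
        = pdr (pdr uz) r z + (1 / r) * pdr uz r z + pdz (pdz uz) r z)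
    ∧ (pdr ur r z + ur r z / r + pdz uz r z = 0)

/-- The Dirichlet integrand `|∇u|²` of an axially symmetric field. -/
noncomputable def dirE (ur uθ uz : ℝ → ℝ → ℝ) (r z : ℝ) : ℝ :=
  (pdr ur r z) ^ 2 + (pdz ur r z) ^ 2 + (pdr uθ r z) ^ 2 + (pdz uθ r z) ^ 2
    + (pdr uz r z) ^ 2 + (pdz uz r z) ^ 2 + ((ur r z) ^ 2 + (uθ r z) ^ 2) / r ^ 2


/-- Sum of the absolute values of `f` and of its partial derivatives up to order two. -/
noncomputable def sup2 (f : ℝ → ℝ → ℝ) (r z : ℝ) : ℝ :=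
  |f r z| + |pdr f r z| + |pdz f r z|
    + |pdr (pdr f) r z| + |pdz (pdr f) r z| + |pdz (pdz f) r z|

/-- One-dimensional second derivative test. -/
theorem second_test (φ φ' : ℝ → ℝ) (c x : ℝ) (h1 : ∀ y, HasDerivAt φ (φ' y) y)
    (h2 : HasDerivAt φ' c x) (hm : IsLocalMax φ x) : φ' x = 0 ∧ c ≤ 0 := by
  have e : deriv φ = φ' := funext fun y => (h1 y).deriv
  have h0 : φ' x = 0 := hm.hasDerivAt_eq_zero (h1 x)
  refine ⟨h0, ?_⟩
  by_contra hc
  push Not at hc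
  have hmin : IsLocalMin φ x := by
    apply isLocalMin_of_deriv_deriv_pos
    · rw [e, h2.deriv]; exact hc
    · rw [e, h0]
    · exact (h1 x).continuousAt
  have hconst : φ =ᶠ[nhds x] fun _ => φ x := by
    filter_upwards [hm, hmin] with y hy1 hy2
    exact le_antisymm hy1 hy2
  have h3 : φ' =ᶠ[nhds x] fun _ => 0 := by
    have := hconst.deriv
    rw [e] at this
    filter_upwards [this] with y hy
    simpa using hy
  have h4 : deriv φ' x = 0 := by
    rw [h3.deriv_eq]; simp
  rw [h2.deriv] at h4
  linarith

/-- Pointwise supersolution inequality for the barrier. -/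
theorem barrier_ineq (P s g g' r a b : ℝ) (hP : P = 4 + s ^ 2) (hg1 : 1 ≤ g) (hg2 : g ≤ 5 / 4)
    (hg' : |g'| ≤ 1) (hr : 10 ≤ r) (ha : |a| ≤ 1 / 10) (hb : |b| ≤ 1 / 10) :
    2 * g + (1 / r) * (2 * s * g) + P * (-2) - P * g / r ^ 2
      - (a * (2 * s * g) + b * (P * g')) - a * (P * g) / r < 0 := by
  have hP4 : 4 ≤ P := by nlinarith [sq_nonneg s]
  have hs : |2 * s| ≤ P / 2 := by
    rw [abs_le]; constructor <;> nlinarith [sq_nonneg (s - 2), sq_nonneg (s + 2)]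
  have hr0 : 0 < r := by linarith
  have hir : 1 / r ≤ 1 / 10 := one_div_le_one_div_of_le (by norm_num) hr
  have hir0 : 0 < 1 / r := by positivity
  have hsg : |2 * s * g| ≤ P / 2 * (5 / 4) := by
    rw [abs_mul, abs_of_nonneg (by linarith : (0:ℝ) ≤ g)]
    exact mul_le_mul hs hg2 (by linarith) (by linarith)
  have t1 : |(1 / r) * (2 * s * g)| ≤ 1 / 10 * (P / 2 * (5 / 4)) := by
    rw [abs_mul, abs_of_pos hir0]
    exact mul_le_mul hir hsg (abs_nonneg _) (by norm_num)
  have t2 : |a * (2 * s * g)| ≤ 1 / 10 * (P / 2 * (5 / 4)) := by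
    rw [abs_mul]
    exact mul_le_mul ha hsg (abs_nonneg _) (by norm_num)
  have t3 : |b * (P * g')| ≤ 1 / 10 * (P * 1) := by
    rw [abs_mul, abs_mul, abs_of_pos (by linarith : (0:ℝ) < P)]
    exact mul_le_mul hb (by gcongr) (by positivity) (by norm_num)
  have t4 : |a * (P * g) / r| ≤ 1 / 10 * (P * (5 / 4)) * (1 / 10) := by
    rw [div_eq_mul_one_div, abs_mul, abs_mul, abs_of_pos hir0,
      abs_of_pos (by positivity : (0:ℝ) < P * g)]
    gcongr
  have t5 : 0 ≤ P * g / r ^ 2 := by positivity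
  have := (abs_le.1 t1).2
  have := (abs_le.1 t2).1
  have := (abs_le.1 t3).1
  have := (abs_le.1 t4).1
  linarith

/-- Comparison with the barrier on the box `[ρ/2, 3ρ/2] × [0,1]`. -/
theorem comparison (f fr fz frr fzz a b : ℝ → ℝ → ℝ) (K ρ : ℝ) (hρ : 20 ≤ ρ)
    (hc : Continuous fun q : ℝ × ℝ => f q.1 q.2)
    (h1 : ∀ r z, HasDerivAt (fun s => f s z) (fr r z) r)
    (h2 : ∀ r z, HasDerivAt (fun s => fr s z) (frr r z) r)
    (h3 : ∀ r z, HasDerivAt (fun t => f r t) (fz r z) z)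
    (h4 : ∀ r z, HasDerivAt (fun t => fz r t) (fzz r z) z)
    (hK : ∀ r z, f r z ≤ K) (hK0 : 0 ≤ K)
    (hb0 : ∀ r, f r 0 = 0) (hb1 : ∀ r, f r 1 = 0)
    (hsm : ∀ r, ρ / 2 ≤ r → ∀ z ∈ Set.Icc (0:ℝ) 1, |a r z| ≤ 1 / 10 ∧ |b r z| ≤ 1 / 10)
    (heq : ∀ r, 0 < r → ∀ z ∈ Set.Icc (0:ℝ) 1,
      (a r z * fr r z + b r z * fz r z) + a r z * f r z / r
        = frr r z + (1 / r) * fr r z + fzz r z - f r z / r ^ 2) :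
    ∀ z ∈ Set.Icc (0:ℝ) 1, f ρ z ≤ 20 * K / ρ ^ 2 := by
  have hρ0 : 0 < ρ := by linarith
  set P : ℝ → ℝ := fun r => 4 + (r - ρ) ^ 2 with hP
  set g : ℝ → ℝ := fun z => 1 + z - z ^ 2 with hg
  have hPpos : ∀ r, 4 ≤ P r := fun r => by simp only [hP]; nlinarith [sq_nonneg (r - ρ)]
  have hg1 : ∀ z ∈ Set.Icc (0:ℝ) 1, 1 ≤ g z := fun z hz => by
    simp only [hg]; nlinarith [hz.1, hz.2, mul_nonneg hz.1 (sub_nonneg.2 hz.2)]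
  have hg2 : ∀ z, g z ≤ 5 / 4 := fun z => by
    simp only [hg]; nlinarith [sq_nonneg (z - 1 / 2)]
  set B : Set (ℝ × ℝ) := Set.Icc (ρ / 2) (3 * ρ / 2) ×ˢ Set.Icc (0:ℝ) 1 with hB
  have hBc : IsCompact B := isCompact_Icc.prod isCompact_Icc
  have hpos : ∀ q ∈ B, 0 < P q.1 * g q.2 := fun q hq =>
    mul_pos (by linarith [hPpos q.1]) (by linarith [hg1 q.2 hq.2])
  have hcont : ContinuousOn (fun q : ℝ × ℝ => f q.1 q.2 / (P q.1 * g q.2)) B := by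
    apply ContinuousOn.div hc.continuousOn
    · simp only [hP, hg]; fun_prop
    · intro q hq; exact (hpos q hq).ne'
  obtain ⟨⟨r, z⟩, hq, hmax⟩ := hBc.exists_isMaxOn
    ⟨(ρ, 0), ⟨⟨by simp; linarith, by simp; linarith⟩, by simp⟩⟩ hcont
  set m : ℝ := f r z / (P r * g z) with hm
  have hle : ∀ q ∈ B, f q.1 q.2 ≤ m * (P q.1 * g q.2) := fun q hq' => by
    have := hmax hq'
    exact (div_le_iff₀ (hpos q hq')).1 this
  have heqm : f r z = m * (P r * g z) := by
    rw [hm, div_mul_cancel₀]; exact (hpos _ hq).ne'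
  have key : m ≤ 4 * K / ρ ^ 2 := by
    by_contra hcon
    push Not at hcon
    have hM0 : 0 ≤ 4 * K / ρ ^ 2 := by positivity
    have hmpos : 0 < m := lt_of_le_of_lt hM0 hcon
    have hfpos : 0 < f r z := by rw [heqm]; exact mul_pos hmpos (hpos _ hq)
    obtain ⟨⟨hr1, hr2⟩, hz1, hz2⟩ := hq
    simp only at hr1 hr2 hz1 hz2
    have hzI : z ∈ Set.Icc (0:ℝ) 1 := ⟨hz1, hz2⟩
    have hz1' : 0 < z := lt_of_le_of_ne hz1 (by rintro rfl; rw [hb0] at hfpos; exact lt_irrefl _ hfpos)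
    have hz2' : z < 1 := lt_of_le_of_ne hz2 (by rintro rfl; rw [hb1] at hfpos; exact lt_irrefl _ hfpos)
    have hends : (r - ρ) ^ 2 < ρ ^ 2 / 4 := by
      by_contra hh
      push Not at hh
      have : f r z ≤ K := hK r z
      rw [heqm] at this
      have h5 : ρ ^ 2 / 4 ≤ P r * g z := by
        have : P r * 1 ≤ P r * g z := by
          have := hPpos r
          exact mul_le_mul_of_nonneg_left (hg1 z hzI) (by linarith)
        simp only [hP] at this ⊢; linarith
      have h6 : m * (ρ ^ 2 / 4) ≤ K := le_trans (mul_le_mul_of_nonneg_left h5 hmpos.le) this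
      rw [div_lt_iff₀ (by positivity)] at hcon
      linarith
    have hr1' : ρ / 2 < r := by nlinarith
    have hr2' : r < 3 * ρ / 2 := by nlinarith
    have hr0 : 0 < r := by linarith
    have dP : ∀ y, HasDerivAt P (2 * (y - ρ)) y := fun y => by
      have := (((hasDerivAt_id y).sub_const ρ).pow 2).const_add 4
      exact this.congr_deriv (by simp)
    have dP2 : ∀ y, HasDerivAt (fun y => 2 * (y - ρ)) 2 y := fun y => by
      have := ((hasDerivAt_id y).sub_const ρ).const_mul 2
      exact this.congr_deriv (by simp)
    have dg : ∀ y, HasDerivAt g (1 - 2 * y) y := fun y => by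
      have := ((hasDerivAt_id y).const_add 1).sub ((hasDerivAt_id y).pow 2)
      exact this.congr_deriv (by simp)
    have dg2 : ∀ y, HasDerivAt (fun y : ℝ => 1 - 2 * y) (-2) y := fun y => by
      have := ((hasDerivAt_id y).const_mul 2).const_sub 1
      exact this.congr_deriv (by simp)
    have R := second_test (fun s => f s z - m * (P s * g z))
      (fun s => fr s z - m * (2 * (s - ρ) * g z)) (frr r z - m * (2 * g z)) r
      (fun y => (h1 y z).sub (((dP y).mul_const _).const_mul _))
      ((h2 r z).sub (((dP2 r).mul_const _).const_mul _))
      (by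
        filter_upwards [Ioo_mem_nhds hr1' hr2'] with s hs
        have := hle (s, z) ⟨⟨hs.1.le, hs.2.le⟩, hzI⟩
        simp only at this
        linarith)
    have Z := second_test (fun t => f r t - m * (P r * g t))
      (fun t => fz r t - m * (P r * (1 - 2 * t))) (fzz r z - m * (P r * (-2))) z
      (fun y => (h3 r y).sub (((dg y).const_mul _).const_mul _))
      ((h4 r z).sub (((dg2 z).const_mul _).const_mul _))
      (by
        filter_upwards [Ioo_mem_nhds hz1' hz2'] with s hs
        have := hle (r, s) ⟨⟨hr1, hr2⟩, ⟨hs.1.le, hs.2.le⟩⟩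
        simp only at this
        linarith)
    obtain ⟨R1, R2⟩ := R
    obtain ⟨Z1, Z2⟩ := Z
    have hab := hsm r hr1 z hzI
    have bar := barrier_ineq (P r) (r - ρ) (g z) (1 - 2 * z) r (a r z) (b r z) rfl
      (hg1 z hzI) (hg2 z) (by rw [abs_le]; constructor <;> linarith) (by linarith) hab.1 hab.2
    have E := heq r hr0 z hzI
    have e1 : fr r z = m * (2 * (r - ρ) * g z) := by linarith
    have e2 : fz r z = m * (P r * (1 - 2 * z)) := by linarith
    rw [e1, e2, heqm] at E
    have bar2 := mul_neg_of_pos_of_neg hmpos bar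
    have : m * (2 * g z + (1 / r) * (2 * (r - ρ) * g z) + P r * (-2) - P r * g z / r ^ 2
      - (a r z * (2 * (r - ρ) * g z) + b r z * (P r * (1 - 2 * z))) - a r z * (P r * g z) / r)
      = m * (2 * g z) + (1 / r) * (m * (2 * (r - ρ) * g z)) + m * (P r * (-2))
        - m * (P r * g z) / r ^ 2
      - (a r z * (m * (2 * (r - ρ) * g z)) + b r z * (m * (P r * (1 - 2 * z))))
        - a r z * (m * (P r * g z)) / r := by ring
    linarith
  intro z' hz'
  have := hle (ρ, z') ⟨⟨by simp; linarith, by simp; linarith⟩, hz'⟩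
  have hPρ : P ρ = 4 := by simp [hP]
  simp only [hPρ] at this
  have hgz := hg1 z' hz'
  calc f ρ z' ≤ m * (4 * g z') := this
    _ ≤ 4 * K / ρ ^ 2 * (4 * g z') := mul_le_mul_of_nonneg_right key (by linarith)
    _ ≤ 4 * K / ρ ^ 2 * (4 * (5 / 4)) :=
        mul_le_mul_of_nonneg_left (by linarith [hg2 z']) (by positivity)
    _ = 20 * K / ρ ^ 2 := by ring

/-- Interpolation: a one-dimensional derivative bound. -/
theorem interp (φ φ' φ'' : ℝ → ℝ) (x y K A : ℝ) (hxy : x ≠ y)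
    (h1 : ∀ t, HasDerivAt φ (φ' t) t) (h2 : ∀ t, HasDerivAt φ' (φ'' t) t)
    (hK : ∀ t, |φ'' t| ≤ K) (hx : |φ x| ≤ A) (hy : |φ y| ≤ A) :
    |φ' x| ≤ 2 * A / |y - x| + K * |y - x| := by
  have hd : 0 < |y - x| := abs_pos.2 (sub_ne_zero.2 hxy.symm)
  have lip : ∀ t, |φ' t - φ' x| ≤ K * |t - x| := fun t => by
    have := convex_univ.norm_image_sub_le_of_norm_hasDerivWithin_le
      (f := φ') (f' := φ'') (C := K) (s := Set.univ)
      (fun t _ => (h2 t).hasDerivWithinAt) (fun t _ => hK t) (Set.mem_univ x) (Set.mem_univ t)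
    simpa [Real.norm_eq_abs] using this
  have hK0 : 0 ≤ K := le_trans (abs_nonneg _) (hK 0)
  obtain ⟨ξ, hξ, e⟩ : ∃ ξ, |ξ - x| ≤ |y - x| ∧ φ' ξ * (y - x) = φ y - φ x := by
    have hcφ : Continuous φ := continuous_iff_continuousAt.2 fun t => (h1 t).continuousAt
    rcases lt_or_gt_of_ne hxy with h | h
    · obtain ⟨ξ, hξ, e⟩ := exists_hasDerivAt_eq_slope φ φ' h hcφ.continuousOn (fun t _ => h1 t)
      refine ⟨ξ, ?_, ?_⟩
      · rw [abs_of_pos (by linarith [hξ.1]), abs_of_pos (by linarith)]; linarith [hξ.2]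
      · rw [e, div_mul_cancel₀]; linarith
    · obtain ⟨ξ, hξ, e⟩ := exists_hasDerivAt_eq_slope φ φ' h hcφ.continuousOn (fun t _ => h1 t)
      refine ⟨ξ, ?_, ?_⟩
      · rw [abs_of_neg (by linarith [hξ.2]), abs_of_neg (by linarith)]; linarith [hξ.1]
      · have : x - y ≠ 0 := by linarith
        rw [e]; field_simp; ring
  have b1 : |φ' ξ| ≤ 2 * A / |y - x| := by
    rw [le_div_iff₀ hd, ← abs_mul, e]
    have := abs_sub (φ y) (φ x)
    linarith
  have b2 := lip ξ
  have b3 : K * |ξ - x| ≤ K * |y - x| := mul_le_mul_of_nonneg_left hξ hK0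
  have b4 : |φ' x| ≤ |φ' ξ| + |φ' ξ - φ' x| := by
    have := abs_sub_abs_le_abs_sub (φ' x) (φ' ξ)
    rw [abs_sub_comm] at this
    linarith
  linarith

/-- Smoothness of `∂_r f`. -/
theorem pdr_smooth (f : ℝ → ℝ → ℝ) (hf : ContDiff ℝ (⊤ : ℕ∞) (fun q : ℝ × ℝ => f q.1 q.2)) :
    ContDiff ℝ (⊤ : ℕ∞) (fun q : ℝ × ℝ => pdr f q.1 q.2) := by
  have h : (fun q : ℝ × ℝ => pdr f q.1 q.2)
      = fun q => fderiv ℝ (fun q : ℝ × ℝ => f q.1 q.2) q (1, 0) := by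
    funext q
    have h1 : HasDerivAt (fun s : ℝ => (s, q.2)) ((1:ℝ), (0:ℝ)) q.1 :=
      (hasDerivAt_id _).prodMk (hasDerivAt_const _ _)
    have h2 := (hf.differentiable (by simp) (q.1, q.2)).hasFDerivAt
    exact (h2.comp_hasDerivAt q.1 h1).deriv
  rw [h]
  exact (hf.fderiv_right (m := (⊤ : ℕ∞)) (by simp)).clm_apply contDiff_const

/-- Smoothness of `∂_z f`. -/
theorem pdz_smooth (f : ℝ → ℝ → ℝ) (hf : ContDiff ℝ (⊤ : ℕ∞) (fun q : ℝ × ℝ => f q.1 q.2)) :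
    ContDiff ℝ (⊤ : ℕ∞) (fun q : ℝ × ℝ => pdz f q.1 q.2) := by
  have h : (fun q : ℝ × ℝ => pdz f q.1 q.2)
      = fun q => fderiv ℝ (fun q : ℝ × ℝ => f q.1 q.2) q (0, 1) := by
    funext q
    have h1 : HasDerivAt (fun s : ℝ => (q.1, s)) ((0:ℝ), (1:ℝ)) q.2 :=
      (hasDerivAt_const _ _).prodMk (hasDerivAt_id _)
    have h2 := (hf.differentiable (by simp) (q.1, q.2)).hasFDerivAt
    exact (h2.comp_hasDerivAt q.2 h1).deriv
  rw [h]
  exact (hf.fderiv_right (m := (⊤ : ℕ∞)) (by simp)).clm_apply contDiff_const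

theorem pdr_has (f : ℝ → ℝ → ℝ) (hf : ContDiff ℝ (⊤ : ℕ∞) (fun q : ℝ × ℝ => f q.1 q.2))
    (r z : ℝ) : HasDerivAt (fun s => f s z) (pdr f r z) r := by
  have : Differentiable ℝ (fun s => f s z) :=
    (hf.differentiable (by simp)).comp (g := fun q : ℝ × ℝ => f q.1 q.2)
      (f := fun s => (s, z)) (by fun_prop)
  exact (this r).hasDerivAt

theorem pdz_has (f : ℝ → ℝ → ℝ) (hf : ContDiff ℝ (⊤ : ℕ∞) (fun q : ℝ × ℝ => f q.1 q.2))
    (r z : ℝ) : HasDerivAt (fun s => f r s) (pdz f r z) z := by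
  have : Differentiable ℝ (fun s => f r s) :=
    (hf.differentiable (by simp)).comp (g := fun q : ℝ × ℝ => f q.1 q.2)
      (f := fun s => (r, s)) (by fun_prop)
  exact (this z).hasDerivAt

/-- Decay of the vorticity components `w^r = −∂_z u^θ` and `w^z = ∂_r u^θ + u^θ/r` in the slab: `|w^r| + |w^z| ≤ C r⁻¹ ln r` for large `r`, with `C` depending only on `C_D` and `K`. -/
theorem slab_vorticity_decay :
    ∀ C_D K : ℝ, ∃ C : ℝ, 0 < C ∧
      ∀ ur uθ uz p : ℝ → ℝ → ℝ,
        ContDiff ℝ (⊤ : ℕ∞) (fun q : ℝ × ℝ => ur q.1 q.2) →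
        ContDiff ℝ (⊤ : ℕ∞) (fun q : ℝ × ℝ => uθ q.1 q.2) →
        ContDiff ℝ (⊤ : ℕ∞) (fun q : ℝ × ℝ => uz q.1 q.2) →
        ContDiff ℝ (⊤ : ℕ∞) (fun q : ℝ × ℝ => p q.1 q.2) →
        ASNS ur uθ uz p (Set.Icc 0 1) →
        (∀ r : ℝ, ur r 0 = 0 ∧ uθ r 0 = 0 ∧ uz r 0 = 0
          ∧ ur r 1 = 0 ∧ uθ r 1 = 0 ∧ uz r 1 = 0) →
        (∀ ε : ℝ, 0 < ε → ∃ R : ℝ, ∀ r : ℝ, R ≤ r → ∀ z ∈ Set.Icc (0:ℝ) 1,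
          |ur r z| + |uθ r z| + |uz r z| < ε) →
        (∀ R : ℝ, 1 ≤ R →
          ∫⁻ q in Set.Icc R (2 * R) ×ˢ Set.Icc (0:ℝ) 1,
            ENNReal.ofReal (dirE ur uθ uz q.1 q.2 * q.1) ≤ ENNReal.ofReal C_D) →
        (∀ r z : ℝ, sup2 ur r z + sup2 uθ r z + sup2 uz r z ≤ K) →
        ∃ r₀ : ℝ, 2 ≤ r₀ ∧ ∀ r : ℝ, r₀ ≤ r → ∀ z ∈ Set.Icc (0:ℝ) 1,
          |-(pdz uθ r z)| + |pdr uθ r z + uθ r z / r| ≤ C * Real.log r / r := by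
  intro C_D K
  refine ⟨83 * |K| + 1, by positivity, ?_⟩
  intro ur uθ uz p _ hθ _ _ hNS hbc hdec _ hK
  obtain ⟨R, hR⟩ := hdec (1 / 10) (by norm_num)
  have hnn : ∀ f r z, 0 ≤ sup2 f r z := fun f r z => by unfold sup2; positivity
  have hKθ : ∀ r z, sup2 uθ r z ≤ K := fun r z => by
    linarith [hK r z, hnn ur r z, hnn uz r z]
  have hK0 : 0 ≤ K := le_trans (hnn uθ 0 0) (hKθ 0 0)
  have kf : ∀ r z, |uθ r z| ≤ K := fun r z => by
    refine le_trans ?_ (hKθ r z); unfold sup2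
    have := abs_nonneg (pdr uθ r z); have := abs_nonneg (pdz uθ r z)
    have := abs_nonneg (pdr (pdr uθ) r z); have := abs_nonneg (pdz (pdr uθ) r z)
    have := abs_nonneg (pdz (pdz uθ) r z); linarith
  have krr : ∀ r z, |pdr (pdr uθ) r z| ≤ K := fun r z => by
    refine le_trans ?_ (hKθ r z); unfold sup2
    have := abs_nonneg (pdr uθ r z); have := abs_nonneg (pdz uθ r z)
    have := abs_nonneg (uθ r z); have := abs_nonneg (pdz (pdr uθ) r z)
    have := abs_nonneg (pdz (pdz uθ) r z); linarith
  have kzz : ∀ r z, |pdz (pdz uθ) r z| ≤ K := fun r z => by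
    refine le_trans ?_ (hKθ r z); unfold sup2
    have := abs_nonneg (pdr uθ r z); have := abs_nonneg (pdz uθ r z)
    have := abs_nonneg (pdr (pdr uθ) r z); have := abs_nonneg (pdz (pdr uθ) r z)
    have := abs_nonneg (uθ r z); linarith
  have d1 := pdr_has uθ hθ
  have d2 := pdr_has (pdr uθ) (pdr_smooth uθ hθ)
  have d3 := pdz_has uθ hθ
  have d4 := pdz_has (pdz uθ) (pdz_smooth uθ hθ)
  have hsm : ∀ ρ, 2 * R ≤ ρ → ∀ r, ρ / 2 ≤ r → ∀ z ∈ Set.Icc (0:ℝ) 1,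
      |ur r z| ≤ 1 / 10 ∧ |uz r z| ≤ 1 / 10 := fun ρ h r hr z hz => by
    have := hR r (by linarith) z hz
    have := abs_nonneg (ur r z); have := abs_nonneg (uθ r z); have := abs_nonneg (uz r z)
    constructor <;> linarith
  have dec : ∀ ρ, 20 ≤ ρ → 2 * R ≤ ρ → ∀ z ∈ Set.Icc (0:ℝ) 1, |uθ ρ z| ≤ 20 * K / ρ ^ 2 := by
    intro ρ h20 h2R z hz
    have up := comparison uθ (pdr uθ) (pdz uθ) (pdr (pdr uθ)) (pdz (pdz uθ)) ur uz K ρ h20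
      hθ.continuous d1 d2 d3 d4 (fun r z => (abs_le.1 (kf r z)).2) hK0
      (fun r => (hbc r).2.1) (fun r => (hbc r).2.2.2.2.1) (hsm ρ h2R)
      (fun r hr z hz => (hNS r hr z hz).2.1) z hz
    have lo := comparison (fun r z => -uθ r z) (fun r z => -pdr uθ r z) (fun r z => -pdz uθ r z)
      (fun r z => -pdr (pdr uθ) r z) (fun r z => -pdz (pdz uθ) r z) ur uz K ρ h20
      hθ.continuous.neg (fun r z => (d1 r z).neg) (fun r z => (d2 r z).neg)
      (fun r z => (d3 r z).neg) (fun r z => (d4 r z).neg)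
      (fun r z => by linarith [(abs_le.1 (kf r z)).1]) hK0
      (fun r => by simp [(hbc r).2.1]) (fun r => by simp [(hbc r).2.2.2.2.1]) (hsm ρ h2R)
      (fun r hr z hz => by
        have := (hNS r hr z hz).2.1
        simp only [mul_neg, neg_div]
        linarith) z hz
    beta_reduce at lo
    rw [abs_le]; constructor <;> linarith
  refine ⟨max 20 (2 * R), le_trans (by norm_num) (le_max_left _ _), ?_⟩
  intro r hr z hz
  have h20 : 20 ≤ r := le_trans (le_max_left _ _) hr
  have h2R : 2 * R ≤ r := le_trans (le_max_right _ _) hr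
  have hr0 : 0 < r := by linarith
  have hinv : 0 < 1 / r := by positivity
  have hinv2 : 1 / r ≤ 1 / 2 := one_div_le_one_div_of_le (by norm_num) (by linarith)
  have hsimp : 2 * (20 * K / r ^ 2) / (1 / r) + K * (1 / r) = 41 * K / r := by
    field_simp; ring
  have bz : |pdz uθ r z| ≤ 41 * K / r := by
    obtain ⟨y, hy, hyd⟩ : ∃ y ∈ Set.Icc (0:ℝ) 1, |y - z| = 1 / r := by
      rcases le_total z (1 / 2) with h | h
      · exact ⟨z + 1 / r, ⟨by linarith [hz.1], by linarith⟩, by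
          rw [add_sub_cancel_left, abs_of_pos hinv]⟩
      · exact ⟨z - 1 / r, ⟨by linarith, by linarith [hz.2]⟩, by
          rw [sub_sub_cancel_left, abs_neg, abs_of_pos hinv]⟩
    have hne : z ≠ y := by
      rintro rfl; simp at hyd; linarith
    have := interp (fun t => uθ r t) (fun t => pdz uθ r t) (fun t => pdz (pdz uθ) r t) z y K
      (20 * K / r ^ 2) hne (d3 r) (d4 r) (kzz r) (dec r h20 h2R z hz) (dec r h20 h2R y hy)
    rw [hyd, hsimp] at this
    exact this
  have br : |pdr uθ r z| ≤ 41 * K / r := by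
    have hyd : |r + 1 / r - r| = 1 / r := by rw [add_sub_cancel_left, abs_of_pos hinv]
    have hle : 20 * K / (r + 1 / r) ^ 2 ≤ 20 * K / r ^ 2 := by
      gcongr; linarith
    have := interp (fun t => uθ t z) (fun t => pdr uθ t z) (fun t => pdr (pdr uθ) t z) r (r + 1 / r)
      K (20 * K / r ^ 2) (by linarith) (fun t => d1 t z) (fun t => d2 t z) (fun t => krr t z)
      (dec r h20 h2R z hz) (le_trans (dec (r + 1 / r) (by linarith) (by linarith) z hz) hle)
    rw [hyd, hsimp] at this
    exact this
  have b0 : |uθ r z / r| ≤ K / r := by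
    rw [abs_div, abs_of_pos hr0]
    exact div_le_div_of_nonneg_right (kf r z) hr0.le
  have hlog : 1 ≤ Real.log r := by
    rw [Real.le_log_iff_exp_le hr0]
    linarith [Real.exp_one_lt_d9]
  rw [abs_neg]
  have tri := abs_add_le (pdr uθ r z) (uθ r z / r)
  have tot : |pdz uθ r z| + |pdr uθ r z + uθ r z / r| ≤ 83 * K / r := by
    have : 83 * K / r = 41 * K / r + 41 * K / r + K / r := by ring
    linarith
  refine le_trans tot (div_le_div_of_nonneg_right ?_ hr0.le)
  rw [abs_of_nonneg hK0]
  nlinarith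
end

section
/- Let u be a smooth axially symmetric solution of the stationary Navier–Stokes system (ASNS) with smooth axially symmetric pressure p on the slab ℝ²×[0,1], satisfying the Dirichlet boundary condition u = 0 at z = 0 and z = 1, u(x) → 0 uniformly as r = |x'| → ∞, and the dyadic Dirichlet bound ∫₀¹∫_{R≤r≤2R} |∇u|² r dr dz ≤ C_D for all R ≥ 1. Let w^r = −∂_z u^θ and w^z = ∂_r u^θ + u^θ/r. Then there exist a constant C > 0, depending only on C_D and on the supremum norms of u and its derivatives up to order two, and r₀ ≥ 2 such that |∂_z w^r(r,z)| + |∂_r w^z(r,z)| ≤ C r^{−3/2} (ln r)^{3/2} for all r ≥ r₀ and z ∈ [0,1]. -/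
open MeasureTheory Real

/-- Joint smoothness of a function of `(r,z)`. -/
def Sm (f : ℝ → ℝ → ℝ) : Prop := ContDiff ℝ (⊤ : ℕ∞) (fun q : ℝ × ℝ => f q.1 q.2)

theorem Sm.diff {f : ℝ → ℝ → ℝ} (hf : Sm f) : Differentiable ℝ (fun q : ℝ × ℝ => f q.1 q.2) :=
  ContDiff.differentiable hf (by simp)

theorem Sm.hr' {f : ℝ → ℝ → ℝ} (hf : Sm f) (r z : ℝ) :
    HasDerivAt (fun s => f s z) (fderiv ℝ (fun q : ℝ × ℝ => f q.1 q.2) (r, z) (1, 0)) r := by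
  have h1 := (hf.diff (r, z)).hasFDerivAt
  have h2 : HasDerivAt (fun s : ℝ => (s, z)) ((1 : ℝ), (0 : ℝ)) r :=
    (hasDerivAt_id r).prodMk (hasDerivAt_const r z)
  exact h1.comp_hasDerivAt r h2

theorem Sm.hz' {f : ℝ → ℝ → ℝ} (hf : Sm f) (r z : ℝ) :
    HasDerivAt (fun t => f r t) (fderiv ℝ (fun q : ℝ × ℝ => f q.1 q.2) (r, z) (0, 1)) z := by
  have h1 := (hf.diff (r, z)).hasFDerivAt
  have h2 : HasDerivAt (fun t : ℝ => (r, t)) ((0 : ℝ), (1 : ℝ)) z :=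
    (hasDerivAt_const z r).prodMk (hasDerivAt_id z)
  exact h1.comp_hasDerivAt z h2

theorem Sm.pdr_eq {f : ℝ → ℝ → ℝ} (hf : Sm f) (r z : ℝ) :
    pdr f r z = fderiv ℝ (fun q : ℝ × ℝ => f q.1 q.2) (r, z) (1, 0) := (hf.hr' r z).deriv

theorem Sm.pdz_eq {f : ℝ → ℝ → ℝ} (hf : Sm f) (r z : ℝ) :
    pdz f r z = fderiv ℝ (fun q : ℝ × ℝ => f q.1 q.2) (r, z) (0, 1) := (hf.hz' r z).deriv

theorem Sm.hr {f : ℝ → ℝ → ℝ} (hf : Sm f) (r z : ℝ) :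
    HasDerivAt (fun s => f s z) (pdr f r z) r := by
  rw [hf.pdr_eq]; exact hf.hr' r z

theorem Sm.hz {f : ℝ → ℝ → ℝ} (hf : Sm f) (r z : ℝ) :
    HasDerivAt (fun t => f r t) (pdz f r z) z := by
  rw [hf.pdz_eq]; exact hf.hz' r z

theorem Sm.fd {f : ℝ → ℝ → ℝ} (hf : Sm f) :
    ContDiff ℝ (⊤ : ℕ∞) (fderiv ℝ (fun q : ℝ × ℝ => f q.1 q.2)) :=
  ContDiff.fderiv_right (m := (⊤ : ℕ∞)) hf (by simp)

theorem Sm.r {f : ℝ → ℝ → ℝ} (hf : Sm f) : Sm (pdr f) := by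
  unfold Sm
  have : (fun q : ℝ × ℝ => pdr f q.1 q.2)
      = fun q => fderiv ℝ (fun q : ℝ × ℝ => f q.1 q.2) q (1, 0) := by
    funext q; exact hf.pdr_eq q.1 q.2
  rw [this]
  exact hf.fd.clm_apply contDiff_const

theorem Sm.z {f : ℝ → ℝ → ℝ} (hf : Sm f) : Sm (pdz f) := by
  unfold Sm
  have : (fun q : ℝ × ℝ => pdz f q.1 q.2)
      = fun q => fderiv ℝ (fun q : ℝ × ℝ => f q.1 q.2) q (0, 1) := by
    funext q; exact hf.pdz_eq q.1 q.2
  rw [this]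
  exact hf.fd.clm_apply contDiff_const

theorem Sm.comm {f : ℝ → ℝ → ℝ} (hf : Sm f) (r z : ℝ) : pdr (pdz f) r z = pdz (pdr f) r z := by
  have e1 : (fun q : ℝ × ℝ => pdr f q.1 q.2)
      = fun q => fderiv ℝ (fun q : ℝ × ℝ => f q.1 q.2) q (1, 0) := by
    funext q; exact hf.pdr_eq q.1 q.2
  have e2 : (fun q : ℝ × ℝ => pdz f q.1 q.2)
      = fun q => fderiv ℝ (fun q : ℝ × ℝ => f q.1 q.2) q (0, 1) := by
    funext q; exact hf.pdz_eq q.1 q.2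
  have hd : DifferentiableAt ℝ (fderiv ℝ (fun q : ℝ × ℝ => f q.1 q.2)) (r, z) :=
    (hf.fd.differentiable (by simp)) _
  rw [hf.z.pdr_eq, hf.r.pdz_eq, e1, e2,
    fderiv_clm_apply hd (differentiableAt_const _), fderiv_clm_apply hd (differentiableAt_const _)]
  have hs : IsSymmSndFDerivAt ℝ (fun q : ℝ × ℝ => f q.1 q.2) (r, z) :=
    ContDiffAt.isSymmSndFDerivAt (n := (⊤ : ℕ∞)) hf.contDiffAt
      (by simp only [minSmoothness_of_isRCLikeNormedField]; exact WithTop.coe_le_coe.2 (le_top : (2 : ℕ∞) ≤ ⊤))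
  simpa using hs (1, 0) (0, 1)

/-- Second derivative test at an interior local maximum. -/
theorem snd_test {f f' : ℝ → ℝ} {x c : ℝ} (h : IsLocalMax f x)
    (hf : ∀ t, HasDerivAt f (f' t) t) (hf' : HasDerivAt f' c x) : f' x = 0 ∧ c ≤ 0 := by
  have h0 : f' x = 0 := h.hasDerivAt_eq_zero (hf x)
  refine ⟨h0, ?_⟩
  by_contra! hc
  have hd : deriv f = f' := funext fun t => (hf t).deriv
  have hmin : IsLocalMin f x := by
    apply isLocalMin_of_deriv_deriv_pos
    · rw [hd, hf'.deriv]; exact hc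
    · rw [hd]; exact h0
    · exact (hf x).continuousAt
  have he : f =ᶠ[nhds x] fun _ => f x := by
    filter_upwards [h, hmin] with t h1 h2 using le_antisymm h1 h2
  have h2 : f' =ᶠ[nhds x] fun _ => 0 := by
    have := he.deriv
    rw [hd] at this
    simpa using this
  have h3 := h2.deriv_eq
  rw [hf'.deriv] at h3
  simp at h3
  linarith

theorem barrier_pt (l β γ z : ℝ) (hl : |l| ≤ 1 / 2) (hβ : |β| ≤ 1 / 4) (hγ : |γ| ≤ 1 / 4)
    (hz : z ∈ Set.Icc (0 : ℝ) 1) :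
    (l ^ 2 + β * l) * (1 + z - z ^ 2) - 2 + γ * (1 - 2 * z) ≤ -1 := by
  obtain ⟨h0, h1⟩ := hz
  have a1 : l ^ 2 ≤ 1 / 4 := by
    have := sq_abs l
    nlinarith [abs_nonneg l]
  have a2 : β * l ≤ 1 / 8 := by
    have := le_abs_self (β * l)
    rw [abs_mul] at this
    nlinarith [abs_nonneg l, abs_nonneg β]
  have a3 : γ * (1 - 2 * z) ≤ 1 / 4 := by
    have := abs_le.1 hγ
    nlinarith
  nlinarith [mul_nonneg h0 (sub_nonneg.2 h1), sq_nonneg (z - 1 / 2)]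

theorem max_principle {Q : ℝ → ℝ → ℝ} (hQ : Sm Q) {β γ : ℝ → ℝ → ℝ} {R B E l : ℝ}
    (hl : 0 < l) (hl2 : l ≤ 1 / 2) (hE : 0 ≤ E) (hB : 0 ≤ B)
    (hβ : ∀ r, R ≤ r → ∀ z ∈ Set.Icc (0 : ℝ) 1, |β r z| ≤ 1 / 4)
    (hγ : ∀ r, R ≤ r → ∀ z ∈ Set.Icc (0 : ℝ) 1, |γ r z| ≤ 1 / 4)
    (h0 : ∀ r, R ≤ r → Q r 0 ≤ 0) (h1 : ∀ r, R ≤ r → Q r 1 ≤ 0)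
    (hgrow : ∀ r, R ≤ r → ∀ z ∈ Set.Icc (0 : ℝ) 1, Q r z ≤ B * exp (r / 4))
    (hL : ∀ r, R ≤ r → ∀ z ∈ Set.Ioo (0 : ℝ) 1,
      -E * exp (-l * r) ≤ pdr (pdr Q) r z + pdz (pdz Q) r z
        + β r z * pdr Q r z + γ r z * pdz Q r z) :
    ∃ A : ℝ, 0 < A ∧ ∀ r, R ≤ r → ∀ z ∈ Set.Icc (0 : ℝ) 1, Q r z ≤ A * exp (-l * r) := by
  set A : ℝ := E + B * exp (R / 4) * exp (l * R) + 1 with hA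
  have hApos : 0 < A := by positivity
  have hAE : E < A := by
    have : 0 ≤ B * exp (R / 4) * exp (l * R) := by positivity
    linarith
  have hAR : B * exp (R / 4) ≤ A * exp (-l * R) := by
    have e : exp (l * R) * exp (-l * R) = 1 := by rw [← exp_add]; simp
    have e3 : 0 < exp (-l * R) := exp_pos _
    have : B * exp (R / 4) = B * exp (R / 4) * exp (l * R) * exp (-l * R) := by
      rw [mul_assoc _ (exp (l * R)), e, mul_one]
    rw [this]
    apply mul_le_mul_of_nonneg_right _ e3.le
    linarith
  -- key comparison
  have key : ∀ ε : ℝ, 0 < ε → ∀ r, R ≤ r → ∀ z ∈ Set.Icc (0 : ℝ) 1,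
      Q r z ≤ (A * exp (-l * r) + ε * exp (1 / 2 * r)) * (1 + z - z ^ 2) := by
    intro ε hε r hr z hz
    obtain ⟨T, hT1, hT2⟩ : ∃ T, r < T ∧ B * exp (T / 4) ≤ ε * exp (1 / 2 * T) := by
      have ht : Filter.Tendsto (fun T : ℝ => exp (T / 4)) Filter.atTop Filter.atTop :=
        tendsto_exp_atTop.comp (Filter.tendsto_id.atTop_div_const (by norm_num))
      obtain ⟨T, hT, hT'⟩ := ((ht.eventually_ge_atTop (B / ε)).and
        (Filter.eventually_gt_atTop r)).exists
      refine ⟨T, hT', ?_⟩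
      have e : exp (1 / 2 * T) = exp (T / 4) * exp (T / 4) := by
        rw [← exp_add]; congr 1; ring
      rw [e, ← mul_assoc]
      apply mul_le_mul_of_nonneg_right _ (exp_pos _).le
      rw [div_le_iff₀ hε] at hT
      linarith
    set D : ℝ → ℝ → ℝ := fun r z =>
      Q r z - (A * exp (-l * r) + ε * exp (1 / 2 * r)) * (1 + z - z ^ 2) with hD
    have hcont : Continuous (fun q : ℝ × ℝ => D q.1 q.2) := by
      have := hQ.continuous
      simp only [hD]
      fun_prop
    have hK : IsCompact (Set.Icc R T ×ˢ Set.Icc (0 : ℝ) 1) := isCompact_Icc.prod isCompact_Icc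
    obtain ⟨⟨r1, z1⟩, ⟨hr1, hz1⟩, hmax⟩ := hK.exists_isMaxOn
      ⟨(r, z), ⟨hr, hT1.le⟩, hz⟩ hcont.continuousOn
    simp only at hr1 hz1
    have hmax' : ∀ a ∈ Set.Icc R T, ∀ b ∈ Set.Icc (0 : ℝ) 1, D a b ≤ D r1 z1 :=
      fun a ha b hb => hmax (a := (a, b)) ⟨ha, hb⟩
    have hfin : D r1 z1 ≤ 0 := by
      by_contra! hpos
      have hW : ∀ r, 0 < A * exp (-l * r) + ε * exp (1 / 2 * r) := fun r => by positivity
      have hge1 : ∀ b ∈ Set.Icc (0 : ℝ) 1, 1 ≤ 1 + b - b ^ 2 := by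
        intro b hb
        nlinarith [mul_nonneg hb.1 (sub_nonneg.2 hb.2)]
      have hz1' := hge1 z1 hz1
      have hΦ : A * exp (-l * r1) + ε * exp (1 / 2 * r1)
          ≤ (A * exp (-l * r1) + ε * exp (1 / 2 * r1)) * (1 + z1 - z1 ^ 2) := by
        nlinarith [hW r1]
      have hQpos : A * exp (-l * r1) + ε * exp (1 / 2 * r1) < Q r1 z1 := by
        simp only [hD] at hpos; linarith
      have p1 : 0 < A * exp (-l * r1) := by positivity
      have p2 : 0 < ε * exp (1 / 2 * r1) := by positivity
      have nz0 : z1 ≠ 0 := by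
        rintro rfl; linarith [h0 r1 hr1.1]
      have nz1 : z1 ≠ 1 := by
        rintro rfl; linarith [h1 r1 hr1.1]
      have nR : r1 ≠ R := by
        intro h
        have := hgrow r1 hr1.1 z1 hz1
        rw [h] at this p2 hQpos
        linarith
      have nT : r1 ≠ T := by
        intro h
        have := hgrow r1 hr1.1 z1 hz1
        rw [h] at this p1 hQpos
        linarith
      have iz : z1 ∈ Set.Ioo (0 : ℝ) 1 :=
        ⟨lt_of_le_of_ne hz1.1 (Ne.symm nz0), lt_of_le_of_ne hz1.2 nz1⟩
      have ir : r1 ∈ Set.Ioo R T :=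
        ⟨lt_of_le_of_ne hr1.1 (Ne.symm nR), lt_of_le_of_ne hr1.2 nT⟩
      have mr : IsLocalMax (fun s => D s z1) r1 := by
        filter_upwards [Icc_mem_nhds ir.1 ir.2] with s hs using hmax' s hs z1 hz1
      have mz : IsLocalMax (fun t => D r1 t) z1 := by
        filter_upwards [Icc_mem_nhds iz.1 iz.2] with t ht using hmax' r1 hr1 t ht
      have he1 : ∀ m s : ℝ, HasDerivAt (fun s => exp (m * s)) (m * exp (m * s)) s := by
        intro m s
        have := ((hasDerivAt_id s).const_mul m).exp
        simpa [mul_comm] using this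
      have dr : ∀ s, HasDerivAt (fun s => D s z1) (pdr Q s z1 -
          (A * (-l * exp (-l * s)) + ε * (1 / 2 * exp (1 / 2 * s))) * (1 + z1 - z1 ^ 2)) s := by
        intro s
        exact (hQ.hr s z1).sub ((((he1 (-l) s).const_mul A).add
          ((he1 (1 / 2) s).const_mul ε)).mul_const _)
      have drr : HasDerivAt (fun s => pdr Q s z1 -
          (A * (-l * exp (-l * s)) + ε * (1 / 2 * exp (1 / 2 * s))) * (1 + z1 - z1 ^ 2))
          (pdr (pdr Q) r1 z1 - (A * (-l * (-l * exp (-l * r1)))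
            + ε * (1 / 2 * (1 / 2 * exp (1 / 2 * r1)))) * (1 + z1 - z1 ^ 2)) r1 := by
        exact (hQ.r.hr r1 z1).sub (((((he1 (-l) r1).const_mul (-l)).const_mul A).add
          (((he1 (1 / 2) r1).const_mul (1 / 2)).const_mul ε)).mul_const _)
      have dz : ∀ t, HasDerivAt (fun t => D r1 t) (pdz Q r1 t -
          (A * exp (-l * r1) + ε * exp (1 / 2 * r1)) * (1 - 2 * t)) t := by
        intro t
        have hp : HasDerivAt (fun t : ℝ => 1 + t - t ^ 2) (1 - 2 * t) t := by
          have := ((hasDerivAt_id t).const_add 1).sub ((hasDerivAt_id t).pow 2)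
          exact this.congr_deriv (by simp)
        exact (hQ.hz r1 t).sub (hp.const_mul _)
      have dzz : HasDerivAt (fun t => pdz Q r1 t -
          (A * exp (-l * r1) + ε * exp (1 / 2 * r1)) * (1 - 2 * t))
          (pdz (pdz Q) r1 z1 - (A * exp (-l * r1) + ε * exp (1 / 2 * r1)) * (-2)) z1 := by
        have hp : HasDerivAt (fun t : ℝ => 1 - 2 * t) (-2) z1 := by
          have := ((hasDerivAt_id z1).const_mul 2).const_sub 1
          simpa using this
        exact (hQ.z.hz r1 z1).sub (hp.const_mul _)
      obtain ⟨q1, q2⟩ := snd_test mr dr drr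
      obtain ⟨q3, q4⟩ := snd_test mz dz dzz
      have hLL := hL r1 hr1.1 z1 iz
      have hb1 := hβ r1 hr1.1 z1 hz1
      have hg1 := hγ r1 hr1.1 z1 hz1
      have b1 := barrier_pt (-l) (β r1 z1) (γ r1 z1) z1
        (by rw [abs_neg, abs_of_pos hl]; exact hl2) hb1 hg1 hz1
      have b2 := barrier_pt (1 / 2) (β r1 z1) (γ r1 z1) z1
        (by rw [abs_of_pos]; norm_num) hb1 hg1 hz1
      have c1 := mul_le_mul_of_nonneg_left b1 p1.le
      have c2 := mul_le_mul_of_nonneg_left b2 p2.le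
      have q1' : pdr Q r1 z1 = (A * (-l * exp (-l * r1)) + ε * (1 / 2 * exp (1 / 2 * r1)))
        * (1 + z1 - z1 ^ 2) := by linarith
      have q3' : pdz Q r1 z1 = (A * exp (-l * r1) + ε * exp (1 / 2 * r1)) * (1 - 2 * z1) := by
        linarith
      rw [q1', q3'] at hLL
      have c3 : E * exp (-l * r1) ≤ A * exp (-l * r1) :=
        mul_le_mul_of_nonneg_right hAE.le (exp_pos _).le
      linarith
    have := (hmax' r ⟨hr, hT1.le⟩ z hz).trans hfin
    simp only [hD] at this
    linarith
  refine ⟨A * 2, by positivity, fun r hr z hz => ?_⟩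
  have hz2 : 1 + z - z ^ 2 ≤ 2 := by nlinarith [hz.1, hz.2]
  have hz3 : 0 ≤ 1 + z - z ^ 2 := by nlinarith [mul_nonneg hz.1 (sub_nonneg.2 hz.2)]
  apply le_of_forall_pos_le_add
  intro η hη
  have hk := key (η / (2 * exp (1 / 2 * r))) (by positivity) r hr z hz
  have e : η / (2 * exp (1 / 2 * r)) * exp (1 / 2 * r) = η / 2 := by
    field_simp
  rw [e] at hk
  have hp : 0 < A * exp (-l * r) := by positivity
  have hm := mul_le_mul_of_nonneg_left hz2 (add_pos hp (half_pos hη)).le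
  linarith

theorem interp_s16 {f f' f'' : ℝ → ℝ} {x h K A δ : ℝ} (hf : ∀ t, HasDerivAt f (f' t) t)
    (hf' : ∀ t, HasDerivAt f' (f'' t) t) (hK : ∀ t, |f'' t| ≤ K) (hδ : 0 < δ)
    (hh : |h| = δ / 2) (h0 : |f x| ≤ A * δ ^ 2) (h1 : |f (x + h)| ≤ A * δ ^ 2) :
    |f' x| ≤ (4 * A + K) * δ := by
  have hK0 : 0 ≤ K := (abs_nonneg _).trans (hK 0)
  have l1 : ∀ t, |f' t - f' x| ≤ K * |t - x| := by
    intro t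
    have := Convex.norm_image_sub_le_of_norm_hasDerivWithin_le (f := f') (f' := f'')
      (s := Set.univ) (x := x) (y := t) (C := K)
      (fun u _ => (hf' u).hasDerivWithinAt) (fun u _ => hK u) convex_univ trivial trivial
    simpa using this
  have l2 : |(f (x + h) - (x + h) * f' x) - (f x - x * f' x)| ≤ K * |h| * |h| := by
    have := Convex.norm_image_sub_le_of_norm_hasDerivWithin_le
      (f := fun t => f t - t * f' x) (f' := fun t => f' t - f' x)
      (s := Set.uIcc x (x + h)) (x := x) (y := x + h) (C := K * |h|)
      (fun u _ => by
        have := (hf u).sub ((hasDerivAt_id u).mul_const (f' x))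
        exact (this.congr_deriv (by simp)).hasDerivWithinAt)
      (fun u hu => by
        refine (l1 u).trans ?_
        apply mul_le_mul_of_nonneg_left _ hK0
        have := Set.abs_sub_left_of_mem_uIcc hu
        simpa using this) (convex_uIcc _ _) Set.left_mem_uIcc Set.right_mem_uIcc
    simpa using this
  have e : h * f' x = f (x + h) - f x
      - ((f (x + h) - (x + h) * f' x) - (f x - x * f' x)) := by ring
  have l3 : |h * f' x| ≤ A * δ ^ 2 + A * δ ^ 2 + K * |h| * |h| := by
    rw [e]
    exact (abs_sub _ _).trans (add_le_add ((abs_sub _ _).trans (add_le_add h1 h0)) l2)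
  rw [abs_mul, hh] at l3
  have l4 : δ * |f' x| ≤ δ * ((4 * A + K) * δ) := by nlinarith [mul_nonneg hK0 (sq_nonneg δ)]
  exact le_of_mul_le_mul_left l4 hδ

theorem deriv_eq_of_ev {F G : ℝ → ℝ} {F' G' x : ℝ} (h : F =ᶠ[nhds x] G)
    (hF : HasDerivAt F F' x) (hG : HasDerivAt G G' x) : F' = G' :=
  hF.unique (hG.congr_of_eventuallyEq h)

/-- The swirl equation. -/
def SwEq (v a b : ℝ → ℝ → ℝ) : Prop := ∀ r : ℝ, 0 < r → ∀ z ∈ Set.Icc (0 : ℝ) 1,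
  (a r z * pdr v r z + b r z * pdz v r z) + a r z * v r z / r
        = pdr (pdr v) r z + (1 / r) * pdr v r z + pdz (pdz v) r z - v r z / r ^ 2

theorem Sm.commf {f : ℝ → ℝ → ℝ} (hf : Sm f) : pdr (pdz f) = pdz (pdr f) := by
  funext r z; exact hf.comm r z

theorem eq_r {v a b : ℝ → ℝ → ℝ} (hv : Sm v) (ha : Sm a) (hb : Sm b) (h : SwEq v a b)
    {r z : ℝ} (hr : 0 < r) (hz : z ∈ Set.Icc (0 : ℝ) 1) :
    pdr (pdr (pdr v)) r z + pdz (pdz (pdr v)) r z + (1 / r - a r z) * pdr (pdr v) r z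
      + -(b r z) * pdz (pdr v) r z
    = pdr a r z * pdr v r z + pdr b r z * pdz v r z
      + (pdr a r z * v r z + a r z * pdr v r z) * (1 / r) - a r z * v r z * (1 / r) ^ 2
      + 2 * (1 / r) ^ 2 * pdr v r z - 2 * (1 / r) ^ 3 * v r z := by
  have ev : (fun s => (a s z * pdr v s z + b s z * pdz v s z) + a s z * v s z / s) =ᶠ[nhds r]
      (fun s => pdr (pdr v) s z + (1 / s) * pdr v s z + pdz (pdz v) s z - v s z / s ^ 2) := by
    filter_upwards [lt_mem_nhds hr] with s hs using h s hs z hz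
  have hr0 : r ≠ 0 := hr.ne'
  have d1 := (((ha.hr r z).mul (hv.r.hr r z)).add ((hb.hr r z).mul (hv.z.hr r z))).add
    (((ha.hr r z).mul (hv.hr r z)).div (hasDerivAt_id r) hr0)
  have d2 := (((hv.r.r.hr r z).add
    (((hasDerivAt_const r (1 : ℝ)).div (hasDerivAt_id r) hr0).mul (hv.r.hr r z))).add
    (hv.z.z.hr r z)).sub ((hv.hr r z).div ((hasDerivAt_id r).pow 2) (pow_ne_zero 2 hr0))
  have := deriv_eq_of_ev ev d1 d2
  simp only [hv.commf, hv.z.commf, id, Pi.mul_apply, Pi.pow_apply, Pi.div_apply, Nat.cast_ofNat,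
    Nat.add_one_sub_one, pow_one] at this
  field_simp at this ⊢
  linear_combination -this

theorem eq_z {v a b : ℝ → ℝ → ℝ} (hv : Sm v) (ha : Sm a) (hb : Sm b) (h : SwEq v a b)
    {r z : ℝ} (hr : 0 < r) (hz : z ∈ Set.Ioo (0 : ℝ) 1) :
    (pdz a r z * pdr v r z + a r z * pdz (pdr v) r z
      + (pdz b r z * pdz v r z + b r z * pdz (pdz v) r z))
      + (pdz a r z * v r z + a r z * pdz v r z) * (1 / r)
    = pdz (pdr (pdr v)) r z + (1 / r) * pdz (pdr v) r z + pdz (pdz (pdz v)) r z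
      - pdz v r z * (1 / r) ^ 2 := by
  have ev : (fun t => (a r t * pdr v r t + b r t * pdz v r t) + a r t * v r t / r) =ᶠ[nhds z]
      (fun t => pdr (pdr v) r t + (1 / r) * pdr v r t + pdz (pdz v) r t - v r t / r ^ 2) := by
    filter_upwards [Icc_mem_nhds hz.1 hz.2] with t ht using h r hr t ht
  have d1 := (((ha.hz r z).mul (hv.r.hz r z)).add ((hb.hz r z).mul (hv.z.hz r z))).add
    (((ha.hz r z).mul (hv.hz r z)).div_const r)
  have d2 := (((hv.r.r.hz r z).add ((hv.r.hz r z).const_mul (1 / r))).add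
    (hv.z.z.hz r z)).sub ((hv.hz r z).div_const (r ^ 2))
  have := deriv_eq_of_ev ev d1 d2
  rw [one_div_pow]
  simp only [div_eq_mul_inv, one_mul] at this ⊢
  linear_combination this

theorem eq_zz {v a b : ℝ → ℝ → ℝ} (hv : Sm v) (ha : Sm a) (hb : Sm b) (h : SwEq v a b)
    {r z : ℝ} (hr : 0 < r) (hz : z ∈ Set.Ioo (0 : ℝ) 1) :
    pdr (pdr (pdz (pdz v))) r z + pdz (pdz (pdz (pdz v))) r z
      + (1 / r - a r z) * pdr (pdz (pdz v)) r z + -(b r z) * pdz (pdz (pdz v)) r z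
    = pdz (pdz a) r z * pdr v r z + 2 * pdz a r z * pdz (pdr v) r z
      + pdz (pdz b) r z * pdz v r z + 2 * pdz b r z * pdz (pdz v) r z
      + (pdz (pdz a) r z * v r z + 2 * pdz a r z * pdz v r z
          + a r z * pdz (pdz v) r z) * (1 / r)
      + pdz (pdz v) r z * (1 / r) ^ 2 := by
  have ev : (fun t => (pdz a r t * pdr v r t + a r t * pdz (pdr v) r t
      + (pdz b r t * pdz v r t + b r t * pdz (pdz v) r t))
      + (pdz a r t * v r t + a r t * pdz v r t) * (1 / r)) =ᶠ[nhds z]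
      (fun t => pdz (pdr (pdr v)) r t + (1 / r) * pdz (pdr v) r t + pdz (pdz (pdz v)) r t
      - pdz v r t * (1 / r) ^ 2) := by
    filter_upwards [Ioo_mem_nhds hz.1 hz.2] with t ht using eq_z hv ha hb h hr ht
  have d1 := ((((ha.z.hz r z).mul (hv.r.hz r z)).add ((ha.hz r z).mul (hv.r.z.hz r z))).add
    (((hb.z.hz r z).mul (hv.z.hz r z)).add ((hb.hz r z).mul (hv.z.z.hz r z)))).add
    ((((ha.z.hz r z).mul (hv.hz r z)).add ((ha.hz r z).mul (hv.z.hz r z))).mul_const (1 / r))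
  have d2 := (((hv.r.r.z.hz r z).add ((hv.r.z.hz r z).const_mul (1 / r))).add
    (hv.z.z.z.hz r z)).sub ((hv.z.hz r z).mul_const ((1 / r) ^ 2))
  have := deriv_eq_of_ev ev d1 d2
  have c1 : pdr (pdz (pdz v)) = pdz (pdz (pdr v)) := by rw [hv.z.commf, hv.commf]
  have c2 : pdr (pdr (pdz (pdz v))) = pdz (pdz (pdr (pdr v))) := by
    rw [c1, hv.r.z.commf, hv.r.commf]
  rw [c2, c1]
  linear_combination -this

theorem mb {x y X Y : ℝ} (hx : |x| ≤ X) (hy : |y| ≤ Y) : |x * y| ≤ X * Y := by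
  rw [abs_mul]
  exact mul_le_mul hx hy (abs_nonneg _) ((abs_nonneg _).trans hx)

theorem final_alg {g δ p q w Y F s β N C M M1 : ℝ} (hg : 0 < g) (hgd : g * δ = 1)
    (hY : |Y| ≤ N * (|p| + |q|) + C * δ) (hw : |w| ≤ M * δ) (hF : |F| ≤ M1 * δ)
    (hs : |s| = 1) (hβ : |β| ≤ 1 / 4) :
    -(N ^ 2 / 2 + C + M ^ 2 / 4 + 2 * (M * M1)) * δ ≤
      s * Y + g * (2 * p ^ 2 + 2 * q ^ 2 + 2 * w * F + (1 / 16 + β / 4) * w ^ 2 + w * p) := by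
  have k1 : ∀ x : ℝ, N * |x| ≤ g * x ^ 2 + N ^ 2 / 4 * δ := by
    intro x
    have h1 : 0 ≤ g * (|x| - N * δ / 2) ^ 2 := by positivity
    have h2 : g * (|x| - N * δ / 2) ^ 2
        = g * x ^ 2 - N * |x| * (g * δ) + N ^ 2 / 4 * δ * (g * δ) := by
      rw [← sq_abs x]; ring
    rw [h2, hgd] at h1
    linarith
  have k2 : g * w ^ 2 ≤ M ^ 2 * δ := by
    have h1 : w ^ 2 ≤ (M * δ) ^ 2 := sq_le_sq' (by linarith [(abs_le.1 hw).1]) (abs_le.1 hw).2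
    calc g * w ^ 2 ≤ g * (M * δ) ^ 2 := mul_le_mul_of_nonneg_left h1 hg.le
      _ = M ^ 2 * δ * (g * δ) := by ring
      _ = M ^ 2 * δ := by rw [hgd, mul_one]
  have k3 : -(M * M1 * δ) ≤ g * (w * F) := by
    have h1 := (abs_le.1 (mb hw hF)).1
    have h2 := mul_le_mul_of_nonneg_left h1 hg.le
    have h3 : g * -(M * δ * (M1 * δ)) = -(M * M1 * δ) * (g * δ) := by ring
    rw [h3, hgd] at h2
    linarith
  have k4 : -|Y| ≤ s * Y := by
    have := neg_abs_le (s * Y)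
    rwa [abs_mul, hs, one_mul] at this
  have k5 : 0 ≤ g * (p + w / 2) ^ 2 := by positivity
  have k6 : 0 ≤ g * ((1 / 16 + β / 4) * w ^ 2) := by
    have : 0 ≤ 1 / 16 + β / 4 := by linarith [(abs_le.1 hβ).1]
    positivity
  have k7 : 0 ≤ g * q ^ 2 := by positivity
  nlinarith [k1 p, k1 q]

theorem exp_quarter (s : ℝ) : HasDerivAt (fun s : ℝ => exp (s / 4)) (1 / 4 * exp (s / 4)) s := by
  have := ((hasDerivAt_id s).div_const 4).exp
  exact this.congr_deriv (by simp [mul_comm])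

/-- Standing hypotheses. -/
structure Hyp (v a b : ℝ → ℝ → ℝ) (K R : ℝ) : Prop where
  hv : Sm v
  ha : Sm a
  hb : Sm b
  eq : SwEq v a b
  v0 : ∀ r, v r 0 = 0
  v1 : ∀ r, v r 1 = 0
  a0 : ∀ r, a r 0 = 0
  a1 : ∀ r, a r 1 = 0
  b0 : ∀ r, b r 0 = 0
  b1 : ∀ r, b r 1 = 0
  hR : 8 ≤ R
  sa : ∀ r, R ≤ r → ∀ z ∈ Set.Icc (0 : ℝ) 1, |a r z| ≤ 1 / 8
  sb : ∀ r, R ≤ r → ∀ z ∈ Set.Icc (0 : ℝ) 1, |b r z| ≤ 1 / 8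
  bv : ∀ r z, sup2 v r z ≤ K
  ba : ∀ r z, sup2 a r z ≤ K
  bb : ∀ r z, sup2 b r z ≤ K

theorem sup2_split {f : ℝ → ℝ → ℝ} {r z K : ℝ} (h : sup2 f r z ≤ K) :
    |f r z| ≤ K ∧ |pdr f r z| ≤ K ∧ |pdz f r z| ≤ K ∧ |pdr (pdr f) r z| ≤ K
      ∧ |pdz (pdr f) r z| ≤ K ∧ |pdz (pdz f) r z| ≤ K := by
  unfold sup2 at h
  have h1 := abs_nonneg (f r z)
  have h2 := abs_nonneg (pdr f r z)
  have h3 := abs_nonneg (pdz f r z)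
  have h4 := abs_nonneg (pdr (pdr f) r z)
  have h5 := abs_nonneg (pdz (pdr f) r z)
  have h6 := abs_nonneg (pdz (pdz f) r z)
  refine ⟨?_, ?_, ?_, ?_, ?_, ?_⟩ <;> linarith

section steps
variable {v a b : ℝ → ℝ → ℝ} {K R : ℝ}

theorem Hyp.K0 (H : Hyp v a b K R) : 0 ≤ K := (abs_nonneg _).trans (sup2_split (H.bv 0 0)).1

theorem inv_small {r : ℝ} (hr : 8 ≤ r) : |1 / r| ≤ 1 / 8 := by
  rw [abs_of_nonneg (by positivity)]
  exact one_div_le_one_div_of_le (by norm_num) hr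

theorem Hyp.gamma_one (H : Hyp v a b K R) {s : ℝ} (hs : |s| = 1) :
    ∃ A : ℝ, 0 < A ∧ ∀ r, R ≤ r → ∀ z ∈ Set.Icc (0 : ℝ) 1,
      s * (r * v r z) ≤ A * exp (-(1 / 2) * r) := by
  have hSm : Sm (fun r z => s * (r * v r z)) := by
    have := H.hv
    unfold Sm at this ⊢
    fun_prop
  have e1 : pdr (fun r z => s * (r * v r z)) = fun r z => s * (1 * v r z + r * pdr v r z) := by
    funext r z
    exact (((hasDerivAt_id r).mul (H.hv.hr r z)).const_mul s).deriv
  have e2 : pdz (fun r z => s * (r * v r z)) = fun r z => s * (r * pdz v r z) := by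
    funext r z
    exact (((H.hv.hz r z).const_mul r).const_mul s).deriv
  have e3 : pdr (pdr (fun r z => s * (r * v r z)))
      = fun r z => s * (1 * pdr v r z + (1 * pdr v r z + r * pdr (pdr v) r z)) := by
    rw [e1]
    funext r z
    exact ((((H.hv.hr r z).const_mul 1).add
      ((hasDerivAt_id r).mul (H.hv.r.hr r z))).const_mul s).deriv
  have e4 : pdz (pdz (fun r z => s * (r * v r z))) = fun r z => s * (r * pdz (pdz v) r z) := by
    rw [e2]
    funext r z
    exact (((H.hv.z.hz r z).const_mul r).const_mul s).deriv
  refine max_principle hSm (β := fun r z => -(1 / r) - a r z) (γ := fun r z => - b r z)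
    (B := 4 * K) (E := 0)
    (by norm_num) le_rfl le_rfl (by linarith [H.K0]) ?_ ?_ ?_ ?_ ?_ ?_
  · intro r hr z hz
    have h1 := abs_le.1 (inv_small (H.hR.trans hr))
    have h2 := abs_le.1 (H.sa r hr z hz)
    exact abs_le.2 ⟨by linarith, by linarith⟩
  · intro r hr z hz
    simp only [abs_neg]
    linarith [H.sb r hr z hz]
  · intro r _; simp [H.v0]
  · intro r _; simp [H.v1]
  · intro r hr z hz
    have hr8 := H.hR.trans hr
    have h1 := (sup2_split (H.bv r z)).1
    have h2 : s * (r * v r z) ≤ r * K := by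
      refine (le_abs_self _).trans ?_
      rw [abs_mul, hs, one_mul, abs_mul, abs_of_pos (by linarith : 0 < r)]
      exact mul_le_mul_of_nonneg_left h1 (by linarith)
    have h3 : r ≤ 4 * exp (r / 4) := by linarith [add_one_le_exp (r / 4)]
    nlinarith [H.K0]
  · intro r hr z hz
    have hr0 : 0 < r := by linarith [H.hR]
    have h := H.eq r hr0 z ⟨hz.1.le, hz.2.le⟩
    rw [e3, e4, e1, e2]
    apply le_of_eq
    field_simp at h ⊢
    linear_combination s * h

theorem Hyp.v_decay (H : Hyp v a b K R) :
    ∃ A : ℝ, 0 < A ∧ ∀ r, R ≤ r → ∀ z ∈ Set.Icc (0 : ℝ) 1,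
      |v r z| ≤ A * exp (-r / 4) ^ 2 := by
  obtain ⟨A1, hA1, h1⟩ := H.gamma_one (s := 1) (by simp)
  obtain ⟨A2, hA2, h2⟩ := H.gamma_one (s := -1) (by simp)
  refine ⟨A1 + A2, by positivity, fun r hr z hz => ?_⟩
  have e : exp (-r / 4) ^ 2 = exp (-(1 / 2) * r) := by
    rw [← exp_nat_mul]; congr 1; push_cast; ring
  rw [e]
  have k1 := h1 r hr z hz
  have k2 := h2 r hr z hz
  have p := exp_pos (-(1 / 2) * r)
  have hr1 : 1 ≤ r := by linarith [H.hR]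
  have q1 := mul_pos hA1 p
  have q2 := mul_pos hA2 p
  have k3 : r * |v r z| ≤ (A1 + A2) * exp (-(1 / 2) * r) := by
    rcases abs_cases (v r z) with ⟨h, _⟩ | ⟨h, _⟩ <;> rw [h] <;> linarith
  nlinarith [abs_nonneg (v r z)]

theorem Hyp.grad_decay (H : Hyp v a b K R) :
    ∃ M : ℝ, 0 < M ∧ ∀ r, R ≤ r → ∀ z ∈ Set.Icc (0 : ℝ) 1,
      |v r z| ≤ M * exp (-r / 4) ∧ |pdr v r z| ≤ M * exp (-r / 4)
        ∧ |pdz v r z| ≤ M * exp (-r / 4) := by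
  obtain ⟨A, hA, h⟩ := H.v_decay
  refine ⟨4 * A + K, by linarith [H.K0], fun r hr z hz => ?_⟩
  have hδ := exp_pos (-r / 4)
  have hδ1 : exp (-r / 4) ≤ 1 := by
    rw [exp_le_one_iff]; linarith [H.hR]
  have hK0 := H.K0
  refine ⟨?_, ?_, ?_⟩
  · refine (h r hr z hz).trans ?_
    nlinarith [mul_pos hA hδ, mul_nonneg hK0 hδ.le]
  · refine interp_s16 (f := fun s => v s z) (f' := fun s => pdr v s z)
      (f'' := fun s => pdr (pdr v) s z) (h := exp (-r / 4) / 2) (fun t => H.hv.hr t z)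
      (fun t => H.hv.r.hr t z) (fun t => (sup2_split (H.bv t z)).2.2.2.1) hδ
      (abs_of_pos (by positivity)) (h r hr z hz) ?_
    refine (h _ (by linarith) z hz).trans ?_
    have : exp (-(r + exp (-r / 4) / 2) / 4) ≤ exp (-r / 4) := by
      apply exp_le_exp.2; linarith
    gcongr
  · rcases le_total z (1 / 2) with hz2 | hz2
    · exact interp_s16 (f := fun s => v r s) (f' := fun s => pdz v r s)
        (f'' := fun s => pdz (pdz v) r s) (h := exp (-r / 4) / 2) (fun t => H.hv.hz r t)
        (fun t => H.hv.z.hz r t) (fun t => (sup2_split (H.bv r t)).2.2.2.2.2) hδ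
        (abs_of_pos (by positivity)) (h r hr z hz)
        (h r hr _ ⟨by linarith [hz.1], by linarith⟩)
    · exact interp_s16 (f := fun s => v r s) (f' := fun s => pdz v r s)
        (f'' := fun s => pdz (pdz v) r s) (h := -(exp (-r / 4) / 2)) (fun t => H.hv.hz r t)
        (fun t => H.hv.z.hz r t) (fun t => (sup2_split (H.bv r t)).2.2.2.2.2) hδ
        (by rw [abs_neg]; exact abs_of_pos (by positivity)) (h r hr z hz)
        (h r hr _ ⟨by linarith, by linarith [hz.2]⟩)

/-- `∂_z² v` vanishes on the boundary. -/
theorem Hyp.bdry (H : Hyp v a b K R) {r z : ℝ} (hr : 0 < r) (hz : z = 0 ∨ z = 1) :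
    pdz (pdz v) r z = 0 ∧ pdr v r z = 0 := by
  have hv0 : ∀ s, v s z = 0 := by rcases hz with rfl | rfl; exacts [H.v0, H.v1]
  have ha0 : ∀ s, a s z = 0 := by rcases hz with rfl | rfl; exacts [H.a0, H.a1]
  have hb0 : ∀ s, b s z = 0 := by rcases hz with rfl | rfl; exacts [H.b0, H.b1]
  have e1 : ∀ s, pdr v s z = 0 := by
    intro s
    simp [pdr, hv0]
  have e2 : pdr (pdr v) r z = 0 := by
    have : (fun s => pdr v s z) = fun _ => 0 := funext e1
    change deriv (fun s => pdr v s z) r = 0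
    rw [this]; simp
  have hzI : z ∈ Set.Icc (0 : ℝ) 1 := by rcases hz with rfl | rfl <;> simp
  have h := H.eq r hr z hzI
  rw [e2, e1, hv0, ha0, hb0] at h
  refine ⟨?_, e1 r⟩
  simp at h
  linarith

theorem Hyp.y_one (H : Hyp v a b K R) {s : ℝ} (hs : |s| = 1) :
    ∃ A : ℝ, 0 < A ∧ ∀ r, R ≤ r → ∀ z ∈ Set.Icc (0 : ℝ) 1,
      s * pdz (pdz v) r z + exp (r / 4) * pdr v r z ^ 2 ≤ A * exp (-(1 / 4) * r) := by
  obtain ⟨M, hM, hG⟩ := H.grad_decay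
  have hK := H.K0
  have hgd : ∀ r : ℝ, exp (r / 4) * exp (-r / 4) = 1 := by
    intro r; rw [← exp_add]; simp [neg_div]
  set Q : ℝ → ℝ → ℝ := fun r z => s * pdz (pdz v) r z + exp (r / 4) * pdr v r z ^ 2 with hQ
  have hSm : Sm Q := by
    have h1 := H.hv.r
    have h2 := H.hv.z.z
    unfold Sm at h1 h2 ⊢
    simp only [hQ]
    fun_prop
  have sq2 : ∀ {f : ℝ → ℝ} {f' x : ℝ}, HasDerivAt f f' x →
      HasDerivAt (fun t => f t ^ 2) (2 * f x * f') x := by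
    intro f f' x h
    exact (h.pow 2).congr_deriv (by simp)
  have e1 : pdr Q = fun r z => s * pdr (pdz (pdz v)) r z
      + (1 / 4 * exp (r / 4) * pdr v r z ^ 2
        + exp (r / 4) * (2 * pdr v r z * pdr (pdr v) r z)) := by
    funext r z
    exact (((H.hv.z.z.hr r z).const_mul s).add
      ((exp_quarter r).mul (sq2 (H.hv.r.hr r z)))).deriv
  have e2 : pdz Q = fun r z => s * pdz (pdz (pdz v)) r z
        + exp (r / 4) * (2 * pdr v r z * pdz (pdr v) r z) := by
    funext r z
    exact (((H.hv.z.z.hz r z).const_mul s).add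
      ((sq2 (H.hv.r.hz r z)).const_mul (exp (r / 4)))).deriv
  have e3 : pdr (pdr Q) = fun r z => s * pdr (pdr (pdz (pdz v))) r z
      + ((1 / 4 * (1 / 4 * exp (r / 4)) * pdr v r z ^ 2
          + 1 / 4 * exp (r / 4) * (2 * pdr v r z * pdr (pdr v) r z))
        + (1 / 4 * exp (r / 4) * (2 * pdr v r z * pdr (pdr v) r z)
          + exp (r / 4) * (2 * pdr (pdr v) r z * pdr (pdr v) r z
              + 2 * pdr v r z * pdr (pdr (pdr v)) r z))) := by
    rw [e1]
    funext r z
    exact (((H.hv.z.z.r.hr r z).const_mul s).add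
      ((((exp_quarter r).const_mul (1 / 4)).mul (sq2 (H.hv.r.hr r z))).add
        ((exp_quarter r).mul (((H.hv.r.hr r z).const_mul 2).mul (H.hv.r.r.hr r z))))).deriv
  have e4 : pdz (pdz Q) = fun r z => s * pdz (pdz (pdz (pdz v))) r z
        + exp (r / 4) * (2 * pdz (pdr v) r z * pdz (pdr v) r z
              + 2 * pdr v r z * pdz (pdz (pdr v)) r z) := by
    rw [e2]
    funext r z
    exact (((H.hv.z.z.z.hz r z).const_mul s).add
      ((((H.hv.r.hz r z).const_mul 2).mul (H.hv.r.z.hz r z)).const_mul (exp (r / 4)))).deriv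
  set N : ℝ := 4 * K + 1 with hN
  set C : ℝ := (5 * K + (3 * K + 1) * (3 * K + 2)) * M with hC
  set M1 : ℝ := (5 * K + 4) * M with hM1
  refine max_principle hSm (β := fun r z => 1 / r - a r z) (γ := fun r z => - b r z)
    (B := K + M ^ 2) (E := N ^ 2 / 2 + C + M ^ 2 / 4 + 2 * (M * M1))
    (by norm_num) (by norm_num) (by positivity) (by positivity) ?_ ?_ ?_ ?_ ?_ ?_
  · intro r hr z hz
    have h1 := abs_le.1 (inv_small (H.hR.trans hr))
    have h2 := abs_le.1 (H.sa r hr z hz)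
    exact abs_le.2 ⟨by linarith, by linarith⟩
  · intro r hr z hz
    simp only [abs_neg]
    linarith [H.sb r hr z hz]
  · intro r hr
    have := H.bdry (r := r) (z := 0) (by linarith [H.hR]) (Or.inl rfl)
    simp [hQ, this.1, this.2]
  · intro r hr
    have := H.bdry (r := r) (z := 1) (by linarith [H.hR]) (Or.inr rfl)
    simp [hQ, this.1, this.2]
  · intro r hr z hz
    have h1 : s * pdz (pdz v) r z ≤ K := by
      refine (le_abs_self _).trans ?_
      rw [abs_mul, hs, one_mul]
      exact (sup2_split (H.bv r z)).2.2.2.2.2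
    have h2 := (hG r hr z hz).2.1
    have hδ1 : exp (-r / 4) ≤ 1 := by
      rw [exp_le_one_iff]; linarith [H.hR]
    have hg1 : 1 ≤ exp (r / 4) := by
      rw [one_le_exp_iff]; linarith [H.hR]
    have h3 : pdr v r z ^ 2 ≤ M ^ 2 := by
      rw [← sq_abs]
      have : |pdr v r z| ≤ M := h2.trans (by nlinarith)
      gcongr
    simp only [hQ]
    nlinarith [mul_le_mul_of_nonneg_left h3 (exp_pos (r / 4)).le]
  · intro r hr z hz
    have hzI : z ∈ Set.Icc (0 : ℝ) 1 := ⟨hz.1.le, hz.2.le⟩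
    have hr0 : 0 < r := by linarith [H.hR]
    have q1 := eq_r H.hv H.ha H.hb H.eq hr0 hzI
    have q2 := eq_zz H.hv H.ha H.hb H.eq hr0 hz
    have q0 := H.eq r hr0 z hzI
    obtain ⟨g0, g1, g2⟩ := hG r hr z hzI
    obtain ⟨a0, a1, a2, -, -, a5⟩ := sup2_split (H.ba r z)
    obtain ⟨b0, b1, b2, -, -, b5⟩ := sup2_split (H.bb r z)
    have hρ : |1 / r| ≤ 1 := (inv_small (H.hR.trans hr)).trans (by norm_num)
    have hβ : |1 / r - a r z| ≤ 1 / 4 := by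
      have h1 := abs_le.1 (inv_small (H.hR.trans hr))
      have h2 := abs_le.1 (H.sa r hr z hzI)
      exact abs_le.2 ⟨by linarith, by linarith⟩
    have q0' : pdz (pdz v) r z = -pdr (pdr v) r z + (a r z * pdr v r z + b r z * pdz v r z
        + a r z * (1 / r * v r z) - 1 / r * pdr v r z + 1 / r * (1 / r * v r z)) := by
      field_simp at q0 ⊢
      linear_combination -q0
    have eδ : exp (-(1 / 4) * r) = exp (-r / 4) := by congr 1; ring
    rw [eδ]
    have hgd' := hgd r
    have hg := exp_pos (r / 4)
    rw [e3, e4, e1, e2]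
    beta_reduce
    clear e1 e2 e3 e4 hG hgd eδ
    generalize exp (r / 4) = g at *
    generalize exp (-r / 4) = δ at *
    generalize 1 / r = ρ at *
    generalize a r z = A0 at *
    generalize b r z = B0 at *
    generalize pdr a r z = Ar at *
    generalize pdr b r z = Br at *
    generalize pdz a r z = Az at *
    generalize pdz b r z = Bz at *
    generalize pdz (pdz a) r z = Azz at *
    generalize pdz (pdz b) r z = Bzz at *
    generalize v r z = V at *
    generalize pdr v r z = W at *
    generalize pdz v r z = Vz at *
    generalize pdr (pdr v) r z = p at *
    generalize pdz (pdr v) r z = q at *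
    generalize pdz (pdz v) r z = y at *
    set Y := pdr (pdr (pdz (pdz v))) r z + pdz (pdz (pdz (pdz v))) r z
      + (ρ - A0) * pdr (pdz (pdz v)) r z + -B0 * pdz (pdz (pdz v)) r z with hYd
    set F := pdr (pdr (pdr v)) r z + pdz (pdz (pdr v)) r z + (ρ - A0) * p + -B0 * q with hFd
    have r0 := mb hρ g0
    have r1 := mb hρ g1
    have r2 := mb hρ g2
    have hFb : |F| ≤ M1 * δ := by
      rw [q1]
      have t1 := abs_le.1 (mb a1 g1)
      have t2 := abs_le.1 (mb b1 g2)
      have t3 := abs_le.1 (mb a1 r0)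
      have t4 := abs_le.1 (mb a0 r1)
      have t5 := abs_le.1 (mb a0 (mb hρ r0))
      have t6 := abs_le.1 (mb hρ r1)
      have t7 := abs_le.1 (mb hρ (mb hρ r0))
      have e : Ar * W + Br * Vz + (Ar * V + A0 * W) * ρ - A0 * V * ρ ^ 2 + 2 * ρ ^ 2 * W
          - 2 * ρ ^ 3 * V = Ar * W + Br * Vz + Ar * (ρ * V) + A0 * (ρ * W) - A0 * (ρ * (ρ * V))
          + 2 * (ρ * (ρ * W)) - 2 * (ρ * (ρ * (ρ * V))) := by ring
      rw [e, hM1]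
      exact abs_le.2 ⟨by linarith, by linarith⟩
    have hyb : |y| ≤ |p| + (3 * K + 2) * (M * δ) := by
      have t1 := abs_le.1 (mb a0 g1)
      have t2 := abs_le.1 (mb b0 g2)
      have t3 := abs_le.1 (mb a0 r0)
      have t4 := abs_le.1 r1
      have t5 := abs_le.1 (mb hρ r0)
      have t6 := neg_abs_le p
      have t7 := le_abs_self p
      rw [q0']
      exact abs_le.2 ⟨by linarith, by linarith⟩
    have hYb : |Y| ≤ N * (|p| + |q|) + C * δ := by
      rw [q2]
      have t1 := abs_le.1 (mb a5 g1)
      have t2 := abs_le.1 (mb a2 (le_refl |q|))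
      have t3 := abs_le.1 (mb b5 g2)
      have t4 := abs_le.1 (mb b2 hyb)
      have t5 := abs_le.1 (mb a5 r0)
      have t6 := abs_le.1 (mb a2 r2)
      have t7 := abs_le.1 (mb a0 (mb hρ hyb))
      have t8 := abs_le.1 (mb hρ (mb hρ hyb))
      have e : Azz * W + 2 * Az * q + Bzz * Vz + 2 * Bz * y
          + (Azz * V + 2 * Az * Vz + A0 * y) * ρ + y * ρ ^ 2
          = Azz * W + 2 * (Az * q) + Bzz * Vz + 2 * (Bz * y)
          + Azz * (ρ * V) + 2 * (Az * (ρ * Vz)) + A0 * (ρ * y) + ρ * (ρ * y) := by ring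
      have n1 := mul_nonneg hK (abs_nonneg p)
      have n2 := mul_nonneg hK (abs_nonneg q)
      have n3 := abs_nonneg q
      rw [e, hN, hC]
      exact abs_le.2 ⟨by linarith, by linarith⟩
    have := final_alg hg hgd' hYb g1 hFb hs hβ
    refine this.trans (le_of_eq ?_)
    rw [hYd, hFd]
    ring

theorem Hyp.y_decay (H : Hyp v a b K R) :
    ∃ M : ℝ, 0 < M ∧ ∀ r, R ≤ r → ∀ z ∈ Set.Icc (0 : ℝ) 1,
      |pdz (pdz v) r z| ≤ M * exp (-r / 4) := by
  obtain ⟨A1, hA1, h1⟩ := H.y_one (s := 1) (by simp)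
  obtain ⟨A2, hA2, h2⟩ := H.y_one (s := -1) (by simp)
  refine ⟨A1 + A2, by positivity, fun r hr z hz => ?_⟩
  have k1 := h1 r hr z hz
  have k2 := h2 r hr z hz
  have eδ : exp (-(1 / 4) * r) = exp (-r / 4) := by congr 1; ring
  rw [eδ] at k1 k2
  have p := exp_pos (-r / 4)
  have q1 := mul_pos hA1 p
  have q2 := mul_pos hA2 p
  have q3 : 0 ≤ exp (r / 4) * pdr v r z ^ 2 := by positivity
  exact abs_le.2 ⟨by linarith, by linarith⟩

theorem Hyp.concl (H : Hyp v a b K R) :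
    ∃ r₀ : ℝ, 2 ≤ r₀ ∧ ∀ r : ℝ, r₀ ≤ r → ∀ z ∈ Set.Icc (0:ℝ) 1,
      |pdz (fun a b => -(pdz v a b)) r z| + |pdr (fun a b => pdr v a b + v a b / a) r z|
        ≤ 1 * (Real.log r) ^ ((3:ℝ)/2) / r ^ ((3:ℝ)/2) := by
  obtain ⟨M, hM, hG⟩ := H.grad_decay
  obtain ⟨M2, hM2, hy⟩ := H.y_decay
  have hK := H.K0
  set D : ℝ := 2 * M2 + 3 * K * M with hD
  have hlim : Filter.Tendsto (fun r : ℝ => D * (r ^ ((3:ℝ)/2) * exp (-(1 / 4) * r)))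
      Filter.atTop (nhds (D * 0)) :=
    (tendsto_rpow_mul_exp_neg_mul_atTop_nhds_zero _ _ (by norm_num)).const_mul D
  rw [mul_zero] at hlim
  obtain ⟨R1, hR1⟩ := Filter.eventually_atTop.1 (hlim.eventually_le_const one_pos)
  refine ⟨max R R1, le_trans (by linarith [H.hR]) (le_max_left _ _), fun r hr z hz => ?_⟩
  have hrR := (le_max_left _ _).trans hr
  have hr1 := hR1 r ((le_max_right _ _).trans hr)
  have hr8 := H.hR.trans hrR
  have hr0 : 0 < r := by linarith
  have e1 : pdz (fun a b => -(pdz v a b)) r z = -pdz (pdz v) r z := (H.hv.z.hz r z).neg.deriv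
  have e2 : pdr (fun a b => pdr v a b + v a b / a) r z
      = pdr (pdr v) r z + (pdr v r z * r - v r z * 1) / r ^ 2 :=
    ((H.hv.r.hr r z).add ((H.hv.hr r z).div (hasDerivAt_id r) hr0.ne')).deriv
  have q0 := H.eq r hr0 z hz
  have e3 : pdr (fun a b => pdr v a b + v a b / a) r z = a r z * pdr v r z + b r z * pdz v r z
      + a r z * (1 / r * v r z) - pdz (pdz v) r z := by
    rw [e2]
    field_simp at q0 ⊢
    linear_combination -q0
  obtain ⟨g0, g1, g2⟩ := hG r hrR z hz
  have a0 := (sup2_split (H.ba r z)).1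
  have b0 := (sup2_split (H.bb r z)).1
  have hρ : |1 / r| ≤ 1 := (inv_small hr8).trans (by norm_num)
  have y0 := hy r hrR z hz
  have hb : |pdz (fun a b => -(pdz v a b)) r z| + |pdr (fun a b => pdr v a b + v a b / a) r z|
      ≤ D * exp (-r / 4) := by
    rw [e1, e3, abs_neg]
    have t1 := abs_le.1 (mb a0 g1)
    have t2 := abs_le.1 (mb b0 g2)
    have t3 := abs_le.1 (mb a0 (mb hρ g0))
    have t4 := abs_le.1 y0
    have : |a r z * pdr v r z + b r z * pdz v r z
      + a r z * (1 / r * v r z) - pdz (pdz v) r z| ≤ M2 * exp (-r / 4)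
        + 3 * K * M * exp (-r / 4) := abs_le.2 ⟨by linarith, by linarith⟩
    rw [hD]; linarith
  refine hb.trans ?_
  have hlog : 1 ≤ Real.log r := by
    rw [Real.le_log_iff_exp_le hr0]
    linarith [Real.exp_one_lt_d9]
  have hl2 : 1 ≤ (Real.log r) ^ ((3:ℝ)/2) := Real.one_le_rpow hlog (by norm_num)
  have hrp : 0 < r ^ ((3:ℝ)/2) := Real.rpow_pos_of_pos hr0 _
  rw [le_div_iff₀ hrp, one_mul]
  refine le_trans (le_of_eq ?_) (hr1.trans hl2)
  have eδ : exp (-(1 / 4) * r) = exp (-r / 4) := by congr 1; ring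
  rw [eδ]; ring

end steps

/-- Decay of `∂_z w^r` and `∂_r w^z`, where `w^r = −∂_z u^θ` and `w^z = ∂_r u^θ + u^θ/r`: `|∂_z w^r| + |∂_r w^z| ≤ C r^{−3/2} (ln r)^{3/2}` for large `r`, with `C` depending only on `C_D` and `K`. -/
theorem slab_vorticity_derivative_decay :
    ∀ C_D K : ℝ, ∃ C : ℝ, 0 < C ∧
      ∀ ur uθ uz p : ℝ → ℝ → ℝ,
        ContDiff ℝ (⊤ : ℕ∞) (fun q : ℝ × ℝ => ur q.1 q.2) →
        ContDiff ℝ (⊤ : ℕ∞) (fun q : ℝ × ℝ => uθ q.1 q.2) →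
        ContDiff ℝ (⊤ : ℕ∞) (fun q : ℝ × ℝ => uz q.1 q.2) →
        ContDiff ℝ (⊤ : ℕ∞) (fun q : ℝ × ℝ => p q.1 q.2) →
        ASNS ur uθ uz p (Set.Icc 0 1) →
        (∀ r : ℝ, ur r 0 = 0 ∧ uθ r 0 = 0 ∧ uz r 0 = 0
          ∧ ur r 1 = 0 ∧ uθ r 1 = 0 ∧ uz r 1 = 0) →
        (∀ ε : ℝ, 0 < ε → ∃ R : ℝ, ∀ r : ℝ, R ≤ r → ∀ z ∈ Set.Icc (0:ℝ) 1,
          |ur r z| + |uθ r z| + |uz r z| < ε) →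
        (∀ R : ℝ, 1 ≤ R →
          ∫⁻ q in Set.Icc R (2 * R) ×ˢ Set.Icc (0:ℝ) 1,
            ENNReal.ofReal (dirE ur uθ uz q.1 q.2 * q.1) ≤ ENNReal.ofReal C_D) →
        (∀ r z : ℝ, sup2 ur r z + sup2 uθ r z + sup2 uz r z ≤ K) →
        ∃ r₀ : ℝ, 2 ≤ r₀ ∧ ∀ r : ℝ, r₀ ≤ r → ∀ z ∈ Set.Icc (0:ℝ) 1,
          |pdz (fun a b => -(pdz uθ a b)) r z| + |pdr (fun a b => pdr uθ a b + uθ a b / a) r z| ≤ C * (Real.log r) ^ ((3:ℝ)/2) / r ^ ((3:ℝ)/2) := by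
  intro C_D K
  refine ⟨1, one_pos, ?_⟩
  intro ur uθ uz p hur huθ huz _ hNS hbd hdecay _ hK
  obtain ⟨R, hR⟩ := hdecay (1 / 8) (by norm_num)
  have hpos : ∀ (f : ℝ → ℝ → ℝ) (r z : ℝ), 0 ≤ sup2 f r z := by
    intro f r z; unfold sup2; positivity
  have H : Hyp uθ ur uz K (max R 8) :=
    { hv := huθ
      ha := hur
      hb := huz
      eq := fun r hr z hz => (hNS r hr z hz).2.1
      v0 := fun r => (hbd r).2.1
      v1 := fun r => (hbd r).2.2.2.2.1
      a0 := fun r => (hbd r).1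
      a1 := fun r => (hbd r).2.2.2.1
      b0 := fun r => (hbd r).2.2.1
      b1 := fun r => (hbd r).2.2.2.2.2
      hR := le_max_right _ _
      sa := fun r hr z hz => by
        have := hR r ((le_max_left _ _).trans hr) z hz
        linarith [abs_nonneg (uθ r z), abs_nonneg (uz r z)]
      sb := fun r hr z hz => by
        have := hR r ((le_max_left _ _).trans hr) z hz
        linarith [abs_nonneg (uθ r z), abs_nonneg (ur r z)]
      bv := fun r z => by linarith [hK r z, hpos ur r z, hpos uθ r z, hpos uz r z]
      ba := fun r z => by linarith [hK r z, hpos ur r z, hpos uθ r z, hpos uz r z]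
      bb := fun r z => by linarith [hK r z, hpos ur r z, hpos uθ r z, hpos uz r z] }
  exact H.concl
end
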